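/- Let d and r₂ be positive integers, k ∈ ℤ_{++}^{r₂}, and let R be the unique polynomial in ℂ[X] with R · [∏_{1≤i≤j≤r₂+1}(X − d(i+j−2)/2)_{⌊(k_i+k_j)/2⌋} · ∏_{1≤i<j≤r₂+1}(X − 1/2 − d(i+j−2)/2)_{⌈(k_i+k_j)/2⌉}] = (X)_{φ₂(k),d} · ∏_{1≤i<j≤r₂}(X − d(i+j−1)/2)_{⌊(k_i+k_j)/2⌋} · ∏_{1≤i≤j≤r₂}(X − 1/2 − d(i+j−1)/2)_{⌈(k_i+k_j)/2⌉}. Suppose 1 ≤ m₁, m₂, m₃ ≤ r₂ with m₁ ≤ m₃ and m₂ ≤ m₃, that k₁ − k_{m₁} ≤ 1, that k_a = 1 for all m₂+1 ≤ a ≤ m₃, and that k_{m₃+1} = 0 (convention k_{r₂+1} = 0). Then every zero λ ∈ ℂ of R is real and: if k₁ ≥ 2 and m₂ < m₃ then (d/2)m₁ − k₁ + 3/2 ≤ λ ≤ (d/2)(m₂+m₃−1) − k_{m₂}/2 + 1/2; if k₁ ≥ 2 and m₂ = m₃ then (d/2)m₁ − k₁ + 3/2 ≤ λ ≤ (d/2)(2m₃−1)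 − ⌈k_{m₃}/2⌉ + 1/2; and if k₁ ≤ 1 then R is the constant polynomial 1. Moreover, for m = 1, …, 2r₂−1, if φ₂(k)_{m+1} = 0 and φ₂(k)_m ≠ 0, then at λ = dm/2 the numerator and the denominator of C₂^{d,2d} vanish to the same order (C₂^{d,2d} is nonzero holomorphic there), while at λ = d(m−1)/2 the denominator vanishes to strictly higher order than the numerator (C₂^{d,2d} has a pole there). -/

import Mathlib

open Polynomial Finset

/-- `(X - c)_m := ∏_{t=0}^{m-1} (X - c + t)` in `ℂ[X]`. -/
noncomputable def pochPoly (c : ℂ) (m : ℕ) : Polynomial ℂ :=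
  ∏ t ∈ Finset.range m, (Polynomial.X - Polynomial.C c + (t : Polynomial ℂ))

/-- `φ₂(k)_a := min{⌊(k_i + k_j)/2⌋ : 1 ≤ i ≤ j ≤ r₂+1, i+j = a+1}`. -/
noncomputable def phi2 (r₂ : ℕ) (k : ℕ → ℕ) (a : ℕ) : ℕ :=
  sInf {m : ℕ | ∃ i j : ℕ, 1 ≤ i ∧ i ≤ j ∧ j ≤ r₂ + 1 ∧ i + j = a + 1 ∧
    m = (k i + k j) / 2}

/-- The denominator of `C₂^{d,2d}`. -/
noncomputable def denom2 (d r₂ : ℕ) (k : ℕ → ℕ) : Polynomial ℂ :=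
  (∏ i ∈ Finset.Icc 1 (r₂ + 1), ∏ j ∈ Finset.Icc i (r₂ + 1),
    pochPoly ((d : ℂ) * ((i : ℂ) + (j : ℂ) - 2) / 2) ((k i + k j) / 2)) *
  ∏ i ∈ Finset.Icc 1 (r₂ + 1), ∏ j ∈ Finset.Icc (i + 1) (r₂ + 1),
    pochPoly (1 / 2 + (d : ℂ) * ((i : ℂ) + (j : ℂ) - 2) / 2) ((k i + k j + 1) / 2)

/-- The numerator of `C₂^{d,2d}`. -/
noncomputable def numer2 (d r₂ : ℕ) (k : ℕ → ℕ) : Polynomial ℂ :=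
  (∏ i ∈ Finset.Icc 1 r₂, ∏ j ∈ Finset.Icc (i + 1) r₂,
    pochPoly ((d : ℂ) * ((i : ℂ) + (j : ℂ) - 1) / 2) ((k i + k j) / 2)) *
  ∏ i ∈ Finset.Icc 1 r₂, ∏ j ∈ Finset.Icc i r₂,
    pochPoly (1 / 2 + (d : ℂ) * ((i : ℂ) + (j : ℂ) - 1) / 2) ((k i + k j + 1) / 2)

/-- The polynomial `(X)_{φ₂(k),d} = ∏_{a=1}^{2r₂}(X − d(a−1)/2)_{φ₂(k)_a}`. -/
noncomputable def phiPoly2 (d r₂ : ℕ) (k : ℕ → ℕ) : Polynomial ℂ :=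
  ∏ a ∈ Finset.Icc 1 (2 * r₂),
    pochPoly ((d : ℂ) * ((a : ℂ) - 1) / 2) (phi2 r₂ k a)


noncomputable def quo2 (c : ℂ) (a b : ℕ) : Polynomial ℂ :=
  ∏ t ∈ Finset.Ico a b, (Polynomial.X - Polynomial.C c + (t : Polynomial ℂ))

lemma lin_eq (c : ℂ) (t : ℕ) :
    (Polynomial.X - Polynomial.C c + (t : Polynomial ℂ)) = X - C (c - t) := by
  simp only [map_sub, map_natCast]; ring

lemma poch_monic (c : ℂ) (m : ℕ) : (pochPoly c m).Monic := by
  unfold pochPoly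
  apply monic_prod_of_monic
  intro t _
  rw [lin_eq]; exact monic_X_sub_C _

lemma quo2_monic (c : ℂ) (a b : ℕ) : (quo2 c a b).Monic := by
  unfold quo2
  apply monic_prod_of_monic
  intro t _
  rw [lin_eq]; exact monic_X_sub_C _

lemma poch_mul_quo2 (c : ℂ) {a b : ℕ} (h : a ≤ b) :
    pochPoly c a * quo2 c a b = pochPoly c b := by
  unfold pochPoly quo2
  exact Finset.prod_range_mul_prod_Ico _ h

lemma quo2_root {c z : ℂ} {a b : ℕ} (h : (quo2 c a b).IsRoot z) :
    ∃ t : ℕ, a ≤ t ∧ t < b ∧ z = c - t := by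
  unfold quo2 at h
  rw [IsRoot.def, eval_prod, Finset.prod_eq_zero_iff] at h
  obtain ⟨t, ht, h⟩ := h
  rw [lin_eq] at h
  rw [Finset.mem_Ico] at ht
  refine ⟨t, ht.1, ht.2, ?_⟩
  simpa [sub_eq_zero] using h

lemma reindexA {M : Type*} [CommMonoid M] (r : ℕ) (F : ℕ → ℕ → M) (G : ℕ → ℕ → M)
    (h : ∀ i j, 1 ≤ i → i ≤ j → j ≤ r + 1 → F i j = G (i + j - 2) i) :
    ∏ i ∈ Icc 1 (r + 1), ∏ j ∈ Icc i (r + 1), F i j =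
      ∏ s ∈ range (2 * r + 1), ∏ i ∈ Icc (max 1 (s + 1 - r)) (s / 2 + 1), G s i := by
  rw [Finset.prod_sigma', Finset.prod_sigma']
  refine Finset.prod_bij' (fun x _ => ⟨x.1 + x.2 - 2, x.1⟩) (fun x _ => ⟨x.2, x.1 + 2 - x.2⟩)
    ?_ ?_ ?_ ?_ ?_
  · rintro ⟨i, j⟩ hx
    simp only [mem_sigma, mem_Icc, mem_range] at hx ⊢
    omega
  · rintro ⟨i, j⟩ hx
    simp only [mem_sigma, mem_Icc, mem_range] at hx ⊢
    omega
  · rintro ⟨i, j⟩ hx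
    simp only [mem_sigma, mem_Icc, mem_range] at hx ⊢
    simp only [Sigma.mk.injEq, heq_eq_eq, true_and]
    omega
  · rintro ⟨i, j⟩ hx
    simp only [mem_sigma, mem_Icc, mem_range] at hx ⊢
    simp only [Sigma.mk.injEq, heq_eq_eq, and_true]
    omega
  · rintro ⟨i, j⟩ hx
    simp only [mem_sigma, mem_Icc] at hx ⊢
    exact h i j hx.1.1 hx.2.1 hx.2.2

lemma reindexB {M : Type*} [CommMonoid M] (r : ℕ) (F : ℕ → ℕ → M) (G : ℕ → ℕ → M)
    (h : ∀ i j, 1 ≤ i → i < j → j ≤ r + 1 → F i j = G (i + j - 2) i) :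
    ∏ i ∈ Icc 1 (r + 1), ∏ j ∈ Icc (i + 1) (r + 1), F i j =
      ∏ s ∈ range (2 * r + 1), ∏ i ∈ Icc (max 1 (s + 1 - r)) ((s + 1) / 2), G s i := by
  rw [Finset.prod_sigma', Finset.prod_sigma']
  refine Finset.prod_bij' (fun x _ => ⟨x.1 + x.2 - 2, x.1⟩) (fun x _ => ⟨x.2, x.1 + 2 - x.2⟩)
    ?_ ?_ ?_ ?_ ?_
  · rintro ⟨i, j⟩ hx
    simp only [mem_sigma, mem_Icc, mem_range] at hx ⊢
    omega
  · rintro ⟨i, j⟩ hx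
    simp only [mem_sigma, mem_Icc, mem_range] at hx ⊢
    omega
  · rintro ⟨i, j⟩ hx
    simp only [mem_sigma, mem_Icc, mem_range] at hx ⊢
    simp only [Sigma.mk.injEq, heq_eq_eq, true_and]
    omega
  · rintro ⟨i, j⟩ hx
    simp only [mem_sigma, mem_Icc, mem_range] at hx ⊢
    simp only [Sigma.mk.injEq, heq_eq_eq, and_true]
    omega
  · rintro ⟨i, j⟩ hx
    simp only [mem_sigma, mem_Icc] at hx ⊢
    exact h i j hx.1.1 hx.2.1 hx.2.2

lemma reindexC {M : Type*} [CommMonoid M] (r : ℕ) (F : ℕ → ℕ → M) (G : ℕ → ℕ → M)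
    (h : ∀ i j, 1 ≤ i → i < j → j ≤ r → F i j = G (i + j - 1) i) :
    ∏ i ∈ Icc 1 r, ∏ j ∈ Icc (i + 1) r, F i j =
      ∏ s ∈ range (2 * r + 1), ∏ i ∈ Icc (max 1 (s + 1 - r)) (s / 2), G s i := by
  rw [Finset.prod_sigma', Finset.prod_sigma']
  refine Finset.prod_bij' (fun x _ => ⟨x.1 + x.2 - 1, x.1⟩) (fun x _ => ⟨x.2, x.1 + 1 - x.2⟩)
    ?_ ?_ ?_ ?_ ?_
  · rintro ⟨i, j⟩ hx
    simp only [mem_sigma, mem_Icc, mem_range] at hx ⊢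
    omega
  · rintro ⟨i, j⟩ hx
    simp only [mem_sigma, mem_Icc, mem_range] at hx ⊢
    omega
  · rintro ⟨i, j⟩ hx
    simp only [mem_sigma, mem_Icc, mem_range] at hx ⊢
    simp only [Sigma.mk.injEq, heq_eq_eq, true_and]
    omega
  · rintro ⟨i, j⟩ hx
    simp only [mem_sigma, mem_Icc, mem_range] at hx ⊢
    simp only [Sigma.mk.injEq, heq_eq_eq, and_true]
    omega
  · rintro ⟨i, j⟩ hx
    simp only [mem_sigma, mem_Icc] at hx ⊢
    exact h i j hx.1.1 hx.2.1 hx.2.2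

lemma reindexD {M : Type*} [CommMonoid M] (r : ℕ) (F : ℕ → ℕ → M) (G : ℕ → ℕ → M)
    (h : ∀ i j, 1 ≤ i → i ≤ j → j ≤ r → F i j = G (i + j - 1) i) :
    ∏ i ∈ Icc 1 r, ∏ j ∈ Icc i r, F i j =
      ∏ s ∈ range (2 * r + 1), ∏ i ∈ Icc (max 1 (s + 1 - r)) ((s + 1) / 2), G s i := by
  rw [Finset.prod_sigma', Finset.prod_sigma']
  refine Finset.prod_bij' (fun x _ => ⟨x.1 + x.2 - 1, x.1⟩) (fun x _ => ⟨x.2, x.1 + 1 - x.2⟩)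
    ?_ ?_ ?_ ?_ ?_
  · rintro ⟨i, j⟩ hx
    simp only [mem_sigma, mem_Icc, mem_range] at hx ⊢
    omega
  · rintro ⟨i, j⟩ hx
    simp only [mem_sigma, mem_Icc, mem_range] at hx ⊢
    omega
  · rintro ⟨i, j⟩ hx
    simp only [mem_sigma, mem_Icc, mem_range] at hx ⊢
    simp only [Sigma.mk.injEq, heq_eq_eq, true_and]
    omega
  · rintro ⟨i, j⟩ hx
    simp only [mem_sigma, mem_Icc, mem_range] at hx ⊢
    simp only [Sigma.mk.injEq, heq_eq_eq, and_true]
    omega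
  · rintro ⟨i, j⟩ hx
    simp only [mem_sigma, mem_Icc] at hx ⊢
    exact h i j hx.1.1 hx.2.1 hx.2.2

lemma prod_skip {M : Type*} [CommMonoid M] (l f p : ℕ) (hp : l ≤ p) (hp' : p ≤ f + 1)
    (g : ℕ → M) :
    ∏ i ∈ Icc l (f + 1), g i = g p * ∏ i ∈ Icc l f, g (if i < p then i else i + 1) := by
  rw [← Finset.mul_prod_erase (Icc l (f + 1)) g (mem_Icc.2 ⟨hp, hp'⟩)]
  congr 1
  symm
  refine Finset.prod_bij' (fun i _ => if i < p then i else i + 1)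
    (fun i _ => if i < p then i else i - 1) ?_ ?_ ?_ ?_ ?_
  · intro i hi
    simp only [mem_Icc, mem_erase] at hi ⊢
    split_ifs <;> omega
  · intro i hi
    simp only [mem_Icc, mem_erase] at hi ⊢
    split_ifs <;> omega
  · intro i hi
    simp only [mem_Icc, mem_erase] at hi ⊢
    split_ifs <;> omega
  · intro i hi
    simp only [mem_Icc, mem_erase] at hi ⊢
    split_ifs <;> omega
  · intro i hi
    rfl

lemma denom2_eq (d r : ℕ) (k : ℕ → ℕ) : denom2 d r k =
    (∏ s ∈ range (2 * r + 1), ∏ i ∈ Icc (max 1 (s + 1 - r)) (s / 2 + 1),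
      pochPoly ((d : ℂ) * s / 2) ((k i + k (s + 2 - i)) / 2)) *
    ∏ s ∈ range (2 * r + 1), ∏ i ∈ Icc (max 1 (s + 1 - r)) ((s + 1) / 2),
      pochPoly (1 / 2 + (d : ℂ) * s / 2) ((k i + k (s + 2 - i) + 1) / 2) := by
  unfold denom2
  rw [reindexA r _ (fun s i => pochPoly ((d : ℂ) * s / 2) ((k i + k (s + 2 - i)) / 2)),
    reindexB r _ (fun s i =>
      pochPoly (1 / 2 + (d : ℂ) * s / 2) ((k i + k (s + 2 - i) + 1) / 2))]
  · intro i j hi hij hj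
    have : i + j - 2 + 2 - i = j := by omega
    rw [this, Nat.cast_sub (by omega)]; push_cast; rfl
  · intro i j hi hij hj
    have : i + j - 2 + 2 - i = j := by omega
    rw [this, Nat.cast_sub (by omega)]; push_cast; rfl

lemma numer2_eq (d r : ℕ) (k : ℕ → ℕ) : numer2 d r k =
    (∏ s ∈ range (2 * r + 1), ∏ i ∈ Icc (max 1 (s + 1 - r)) (s / 2),
      pochPoly ((d : ℂ) * s / 2) ((k i + k (s + 1 - i)) / 2)) *
    ∏ s ∈ range (2 * r + 1), ∏ i ∈ Icc (max 1 (s + 1 - r)) ((s + 1) / 2),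
      pochPoly (1 / 2 + (d : ℂ) * s / 2) ((k i + k (s + 1 - i) + 1) / 2) := by
  unfold numer2
  rw [reindexC r _ (fun s i => pochPoly ((d : ℂ) * s / 2) ((k i + k (s + 1 - i)) / 2)),
    reindexD r _ (fun s i =>
      pochPoly (1 / 2 + (d : ℂ) * s / 2) ((k i + k (s + 1 - i) + 1) / 2))]
  · intro i j hi hij hj
    have : i + j - 1 + 1 - i = j := by omega
    rw [this, Nat.cast_sub (by omega)]; push_cast; rfl
  · intro i j hi hij hj
    have : i + j - 1 + 1 - i = j := by omega
    rw [this, Nat.cast_sub (by omega)]; push_cast; rfl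

lemma phi2_le (r : ℕ) (k : ℕ → ℕ) (a i j : ℕ) (h1 : 1 ≤ i) (h2 : i ≤ j) (h3 : j ≤ r + 1)
    (h : i + j = a + 1) : phi2 r k a ≤ (k i + k j) / 2 :=
  Nat.sInf_le ⟨i, j, h1, h2, h3, h, rfl⟩

lemma phi2_mem (r : ℕ) (k : ℕ → ℕ) (a : ℕ) (h1 : 1 ≤ a) (h2 : a ≤ 2 * r + 1) :
    ∃ i j, 1 ≤ i ∧ i ≤ j ∧ j ≤ r + 1 ∧ i + j = a + 1 ∧ phi2 r k a = (k i + k j) / 2 := by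
  have : {m : ℕ | ∃ i j : ℕ, 1 ≤ i ∧ i ≤ j ∧ j ≤ r + 1 ∧ i + j = a + 1 ∧
      m = (k i + k j) / 2}.Nonempty :=
    ⟨_, (a + 1) / 2, a + 1 - (a + 1) / 2, by omega, by omega, by omega, by omega, rfl⟩
  exact Nat.sInf_mem this

lemma phiPoly2_eq (d r : ℕ) (k : ℕ → ℕ) (hk0 : k (r + 1) = 0) : phiPoly2 d r k =
    ∏ s ∈ range (2 * r + 1), pochPoly ((d : ℂ) * s / 2) (phi2 r k (s + 1)) := by
  unfold phiPoly2
  have h0 : phi2 r k (2 * r + 1) = 0 := by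
    have := phi2_le r k (2 * r + 1) (r + 1) (r + 1) (by omega) le_rfl le_rfl (by omega)
    rw [hk0] at this; simpa using this
  rw [Finset.prod_range_succ, h0]
  rw [show pochPoly ((d : ℂ) * ((2 * r : ℕ) : ℂ) / 2) 0 = 1 by simp [pochPoly], mul_one]
  refine Finset.prod_bij' (fun a _ => a - 1) (fun s _ => s + 1) ?_ ?_ ?_ ?_ ?_
  · intro a ha; simp only [mem_Icc, mem_range] at ha ⊢; omega
  · intro a ha; simp only [mem_Icc, mem_range] at ha ⊢; omega
  · intro a ha; simp only [mem_Icc, mem_range] at ha ⊢; omega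
  · intro a ha; simp only [mem_Icc, mem_range] at ha ⊢; omega
  · intro a ha
    simp only [mem_Icc] at ha
    rw [Nat.cast_sub ha.1, Nat.sub_add_cancel ha.1]; push_cast; rfl

lemma denom2_monic (d r : ℕ) (k : ℕ → ℕ) : (denom2 d r k).Monic := by
  unfold denom2
  exact (monic_prod_of_monic _ _ fun i _ => monic_prod_of_monic _ _ fun j _ => poch_monic _ _).mul
    (monic_prod_of_monic _ _ fun i _ => monic_prod_of_monic _ _ fun j _ => poch_monic _ _)

lemma numer2_monic (d r : ℕ) (k : ℕ → ℕ) : (numer2 d r k).Monic := by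
  unfold numer2
  exact (monic_prod_of_monic _ _ fun i _ => monic_prod_of_monic _ _ fun j _ => poch_monic _ _).mul
    (monic_prod_of_monic _ _ fun i _ => monic_prod_of_monic _ _ fun j _ => poch_monic _ _)

lemma phiPoly2_monic (d r : ℕ) (k : ℕ → ℕ) : (phiPoly2 d r k).Monic := by
  unfold phiPoly2
  exact monic_prod_of_monic _ _ fun i _ => poch_monic _ _

/-- Structure of the roots of `R`. -/
lemma root_structure (d r : ℕ) (k : ℕ → ℕ)
    (hk : ∀ i j, 1 ≤ i → i ≤ j → j ≤ r + 1 → k j ≤ k i)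
    (hk0 : k (r + 1) = 0) (R : Polynomial ℂ)
    (hR : R * denom2 d r k = phiPoly2 d r k * numer2 d r k) (z : ℂ) (hz : R.IsRoot z) :
    (∃ s t i j : ℕ, 1 ≤ i ∧ i ≤ j ∧ j ≤ r ∧ i + j = s + 1 ∧
      (k i + k (j + 1) + 1) / 2 ≤ t ∧ t < (k i + k j + 1) / 2 ∧
      z = 1 / 2 + (d : ℂ) * s / 2 - t) ∨
    (∃ s t i j p q : ℕ, 1 ≤ i ∧ i < j ∧ j ≤ r ∧ i + j = s + 1 ∧
      1 ≤ p ∧ p ≤ q ∧ q ≤ r + 1 ∧ p + q = s + 2 ∧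
      (∀ a b, 1 ≤ a → a ≤ b → b ≤ r + 1 → a + b = s + 2 → (k p + k q) / 2 ≤ (k a + k b) / 2) ∧
      t < (k i + k j) / 2 ∧
      ((i < p ∧ (k i + k (j + 1)) / 2 ≤ t) ∨ (p ≤ i ∧ (k (i + 1) + k j) / 2 ≤ t)) ∧
      z = (d : ℂ) * s / 2 - t) := by
  have hp : ∀ s : ℕ, ∃ p, s ∈ range (2 * r + 1) → max 1 (s + 1 - r) ≤ p ∧ p ≤ s / 2 + 1 ∧
      phi2 r k (s + 1) = (k p + k (s + 2 - p)) / 2 := by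
    intro s
    by_cases hs : s ∈ range (2 * r + 1)
    · rw [mem_range] at hs
      obtain ⟨i, j, h1, h2, h3, h4, h5⟩ := phi2_mem r k (s + 1) (by omega) (by omega)
      refine ⟨i, fun _ => ⟨by omega, by omega, ?_⟩⟩
      rw [h5, show s + 2 - i = j by omega]
    · exact ⟨0, fun h => absurd h hs⟩
  choose p hp using hp
  let A : ℕ → ℕ → ℕ := fun s i =>
    (k (if i < p s then i else i + 1) + k (s + 2 - (if i < p s then i else i + 1))) / 2
  have key : phiPoly2 d r k * numer2 d r k =
    ((∏ s ∈ range (2 * r + 1), ∏ i ∈ Icc (max 1 (s + 1 - r)) (s / 2),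
      quo2 ((d : ℂ) * s / 2) (A s i) ((k i + k (s + 1 - i)) / 2)) *
    ∏ s ∈ range (2 * r + 1), ∏ i ∈ Icc (max 1 (s + 1 - r)) ((s + 1) / 2),
      quo2 (1 / 2 + (d : ℂ) * s / 2) ((k i + k (s + 2 - i) + 1) / 2)
        ((k i + k (s + 1 - i) + 1) / 2)) * denom2 d r k := by
    rw [phiPoly2_eq d r k hk0, numer2_eq, denom2_eq]
    rw [← mul_assoc, mul_mul_mul_comm]
    congr 1
    · rw [← Finset.prod_mul_distrib, ← Finset.prod_mul_distrib]
      refine Finset.prod_congr rfl fun s hs => ?_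
      obtain ⟨h1, h2, h3⟩ := hp s hs
      rw [prod_skip _ _ (p s) h1 h2, h3, mul_left_comm]
      congr 1
      rw [← Finset.prod_mul_distrib]
      refine Finset.prod_congr rfl fun i hi => ?_
      rw [mul_comm (quo2 _ _ _)]
      refine (poch_mul_quo2 _ ?_).symm
      simp only [mem_Icc, mem_range] at hi hs
      apply Nat.div_le_div_right
      split_ifs
      · exact Nat.add_le_add_left (hk _ _ (by omega) (by omega) (by omega)) _
      · rw [show s + 2 - (i + 1) = s + 1 - i by omega]
        exact Nat.add_le_add_right (hk _ _ (by omega) (by omega) (by omega)) _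
    · rw [← Finset.prod_mul_distrib]
      refine Finset.prod_congr rfl fun s hs => ?_
      rw [← Finset.prod_mul_distrib]
      refine Finset.prod_congr rfl fun i hi => ?_
      rw [mul_comm (quo2 _ _ _)]
      refine (poch_mul_quo2 _ ?_).symm
      simp only [mem_Icc, mem_range] at hi hs
      apply Nat.div_le_div_right
      have := hk (s + 1 - i) (s + 2 - i) (by omega) (by omega) (by omega)
      omega
  rw [key] at hR
  have hR' := mul_right_cancel₀ (denom2_monic d r k).ne_zero hR
  rw [hR', root_mul] at hz
  rcases hz with hz | hz
  · right
    rw [IsRoot.def, eval_prod, Finset.prod_eq_zero_iff] at hz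
    obtain ⟨s, hs, hz⟩ := hz
    rw [eval_prod, Finset.prod_eq_zero_iff] at hz
    obtain ⟨i, hi, hz⟩ := hz
    obtain ⟨t, h1, h2, rfl⟩ := quo2_root hz
    obtain ⟨h3, h4, h5⟩ := hp s hs
    simp only [mem_Icc, mem_range] at hi hs
    refine ⟨s, t, i, s + 1 - i, p s, s + 2 - p s, by omega, by omega, by omega, by omega,
      by omega, by omega, by omega, by omega, ?_, h2, ?_, rfl⟩
    · intro a b ha hab hb hs'
      rw [← h5]
      exact phi2_le r k _ _ _ ha hab hb hs'
    · simp only [A] at h1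
      by_cases hip : i < p s
      · left
        simp only [hip, if_true] at h1
        refine ⟨hip, ?_⟩
        rw [show s + 1 - i + 1 = s + 2 - i by omega]; exact h1
      · right
        simp only [hip, if_false] at h1
        refine ⟨by omega, ?_⟩
        rw [show s + 1 - i = s + 2 - (i + 1) by omega]; exact h1
  · left
    rw [IsRoot.def, eval_prod, Finset.prod_eq_zero_iff] at hz
    obtain ⟨s, hs, hz⟩ := hz
    rw [eval_prod, Finset.prod_eq_zero_iff] at hz
    obtain ⟨i, hi, hz⟩ := hz
    obtain ⟨t, h1, h2, rfl⟩ := quo2_root hz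
    simp only [mem_Icc, mem_range] at hi hs
    refine ⟨s, t, i, s + 1 - i, by omega, by omega, by omega, by omega, ?_, h2, rfl⟩
    rw [show s + 1 - i + 1 = s + 2 - i by omega]; exact h1

lemma bounds_aux (d r : ℕ) (hd : 0 < d) (k : ℕ → ℕ)
    (hk : ∀ i j, 1 ≤ i → i ≤ j → j ≤ r + 1 → k j ≤ k i)
    (hk0 : k (r + 1) = 0)
    (m₁ m₂ m₃ : ℕ) (hm1 : 1 ≤ m₁) (hm2 : 1 ≤ m₂) (hm4 : m₃ ≤ r)
    (hm5 : m₁ ≤ m₃) (hm6 : m₂ ≤ m₃)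
    (hk1 : k 1 ≤ k m₁ + 1)
    (hkc : ∀ a, m₂ + 1 ≤ a → a ≤ m₃ → k a = 1) (hk3 : k (m₃ + 1) = 0)
    (R : Polynomial ℂ)
    (hR : R * denom2 d r k = phiPoly2 d r k * numer2 d r k) (z : ℂ) (hz : R.IsRoot z) :
    z.im = 0 ∧ (d : ℝ) / 2 * (m₁ : ℝ) - (k 1 : ℝ) + 3 / 2 ≤ z.re ∧
    (m₂ < m₃ → z.re ≤ (d : ℝ) / 2 * ((m₂ : ℝ) + (m₃ : ℝ) - 1) - (k m₂ : ℝ) / 2 + 1 / 2) ∧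
    (m₂ = m₃ → z.re ≤ (d : ℝ) / 2 * (2 * (m₃ : ℝ) - 1) - (((k m₃ + 1) / 2 : ℕ) : ℝ) + 1 / 2) := by
  have hz0 : ∀ j, m₃ + 1 ≤ j → j ≤ r + 1 → k j = 0 := fun j h1 h2 => by
    have := hk (m₃ + 1) j (by omega) h1 h2
    omega
  have hd1 : (1 : ℝ) ≤ d := by exact_mod_cast hd
  rcases root_structure d r k hk hk0 R hR z hz with
    ⟨s, t, i, j, h1, h2, h3, h4, h5, h6, rfl⟩ |
    ⟨s, t, i, j, p, q, h1, h2, h3, h4, p1, p2, p3, p4, hmin, h5, h6, rfl⟩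
  · rw [show (1 / 2 + (d : ℂ) * s / 2 - t) = ((1 / 2 + (d : ℝ) * s / 2 - t : ℝ) : ℂ) by
      push_cast; ring, Complex.ofReal_im, Complex.ofReal_re]
    have a1 := hk 1 i le_rfl h1 (by omega)
    have a2 := hk i j h1 h2 (by omega)
    have a3 := hk j (j + 1) (by omega) (by omega) (by omega)
    have hj : j ≤ m₃ := by
      by_contra hj
      have := hz0 j (by omega) (by omega)
      have := hz0 (j + 1) (by omega) (by omega)
      omega
    refine ⟨rfl, ?_, ?_, ?_⟩
    · have e1 : m₁ ≤ s := by
        by_contra hs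
        have := hk (j + 1) m₁ (by omega) (by omega) (by omega)
        omega
      have e2 : t + 1 ≤ k 1 := by omega
      have e1' : (m₁ : ℝ) ≤ s := by exact_mod_cast e1
      have e2' : (t : ℝ) + 1 ≤ k 1 := by exact_mod_cast e2
      nlinarith
    · intro hlt
      have hi : i ≤ m₂ := by
        by_contra hi
        have := hkc i (by omega) (by omega)
        have := hkc j (by omega) (by omega)
        omega
      have b := hk i m₂ h1 hi (by omega)
      have e1 : s + 1 ≤ m₂ + m₃ := by omega
      have e2 : k m₂ ≤ 2 * t := by omega
      have e1' : (s : ℝ) + 1 ≤ m₂ + m₃ := by exact_mod_cast e1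
      have e2' : (k m₂ : ℝ) ≤ 2 * t := by exact_mod_cast e2
      nlinarith
    · intro heq
      have b := hk i m₃ h1 (by omega) (by omega)
      have e1 : s + 1 ≤ 2 * m₃ := by omega
      have e2 : (k m₃ + 1) / 2 ≤ t := by omega
      have e1' : (s : ℝ) + 1 ≤ 2 * m₃ := by exact_mod_cast e1
      have e2' : (((k m₃ + 1) / 2 : ℕ) : ℝ) ≤ t := by exact_mod_cast e2
      nlinarith
  · rw [show ((d : ℂ) * s / 2 - t) = (((d : ℝ) * s / 2 - t : ℝ) : ℂ) by
      push_cast; ring, Complex.ofReal_im, Complex.ofReal_re]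
    have a1 := hk 1 i le_rfl h1 (by omega)
    have a2 := hk i j h1 h2.le (by omega)
    have a3 := hk j (j + 1) (by omega) (by omega) (by omega)
    have a4 := hk i (i + 1) (by omega) (by omega) (by omega)
    have a5 := hk (i + 1) j (by omega) (by omega) (by omega)
    have b1 := hmin i (j + 1) h1 (by omega) (by omega) (by omega)
    have b2 := hmin (i + 1) j (by omega) (by omega) (by omega) (by omega)
    have hj : j ≤ m₃ := by
      by_contra hj
      have := hz0 j (by omega) (by omega)
      have := hz0 (j + 1) (by omega) (by omega)
      rcases h6 with ⟨h6, h7⟩ | ⟨h6, h7⟩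
      · omega
      · have := hz0 q (by omega) (by omega)
        have := hk p i p1 h6 (by omega)
        omega
    refine ⟨rfl, ?_, ?_, ?_⟩
    · have e2 : t + 2 ≤ k 1 := by
        by_contra hc
        rcases h6 with ⟨h6, h7⟩ | ⟨h6, h7⟩
        · have := hk p j (by omega) (by omega) (by omega)
          have := hk q j (by omega) (by omega) (by omega)
          omega
        · omega
      have e1 : m₁ ≤ s := by
        by_contra hs
        have := hk (j + 1) m₁ (by omega) (by omega) (by omega)
        omega
      have e1' : (m₁ : ℝ) ≤ s := by exact_mod_cast e1
      have e2' : (t : ℝ) + 2 ≤ k 1 := by exact_mod_cast e2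
      nlinarith
    · intro hlt
      have hi : i ≤ m₂ := by
        by_contra hi
        have := hkc i (by omega) (by omega)
        have := hkc j (by omega) (by omega)
        have := hkc (i + 1) (by omega) (by omega)
        rcases h6 with ⟨h6, h7⟩ | ⟨h6, h7⟩
        · have := hkc p (by omega) (by omega)
          have := hkc q (by omega) (by omega)
          omega
        · omega
      have b := hk i m₂ h1 hi (by omega)
      have e1 : s + 1 ≤ m₂ + m₃ := by omega
      have e2 : k m₂ ≤ 2 * t + 1 := by
        rcases h6 with ⟨h6, h7⟩ | ⟨h6, h7⟩
        · omega
        · have := hk p m₂ (by omega) (by omega) (by omega)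
          omega
      have e1' : (s : ℝ) + 1 ≤ m₂ + m₃ := by exact_mod_cast e1
      have e2' : (k m₂ : ℝ) ≤ 2 * t + 1 := by exact_mod_cast e2
      nlinarith
    · intro heq
      have b := hk i m₃ h1 (by omega) (by omega)
      have b' := hk (i + 1) m₃ (by omega) (by omega) (by omega)
      have e1 : s + 2 ≤ 2 * m₃ := by omega
      have e2 : (k m₃ + 1) / 2 ≤ t + 1 := by omega
      have e1' : (s : ℝ) + 2 ≤ 2 * m₃ := by exact_mod_cast e1
      have e2' : (((k m₃ + 1) / 2 : ℕ) : ℝ) ≤ t + 1 := by exact_mod_cast e2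
      nlinarith

lemma R_monic (d r : ℕ) (k : ℕ → ℕ) (R : Polynomial ℂ)
    (hR : R * denom2 d r k = phiPoly2 d r k * numer2 d r k) : R.Monic := by
  refine (denom2_monic d r k).of_mul_monic_right ?_
  rw [hR]
  exact (phiPoly2_monic d r k).mul (numer2_monic d r k)

lemma R_eq_one (d r : ℕ) (k : ℕ → ℕ)
    (hk : ∀ i j, 1 ≤ i → i ≤ j → j ≤ r + 1 → k j ≤ k i)
    (hk0 : k (r + 1) = 0) (R : Polynomial ℂ)
    (hR : R * denom2 d r k = phiPoly2 d r k * numer2 d r k) (h : k 1 ≤ 1) : R = 1 := by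
  have hmon := R_monic d r k R hR
  by_contra hne
  have hdeg : R.degree ≠ 0 := by
    intro h0
    exact hne (hmon.natDegree_eq_zero.1 (natDegree_eq_of_degree_eq_some h0))
  obtain ⟨z, hz⟩ := IsAlgClosed.exists_root R hdeg
  rcases root_structure d r k hk hk0 R hR z hz with
    ⟨s, t, i, j, h1, h2, h3, h4, h5, h6, rfl⟩ |
    ⟨s, t, i, j, p, q, h1, h2, h3, h4, p1, p2, p3, p4, hmin, h5, h6, rfl⟩
  · have a1 := hk 1 i le_rfl h1 (by omega)
    have a2 := hk i j h1 h2 (by omega)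
    omega
  · have a1 := hk 1 i le_rfl h1 (by omega)
    have a2 := hk i j h1 h2.le (by omega)
    have a4 := hk i (i + 1) (by omega) (by omega) (by omega)
    have a5 := hk (i + 1) j (by omega) (by omega) (by omega)
    have b1 := hmin i (j + 1) h1 (by omega) (by omega) (by omega)
    rcases h6 with ⟨h6, h7⟩ | ⟨h6, h7⟩
    · have := hk p j (by omega) (by omega) (by omega)
      have := hk q j (by omega) (by omega) (by omega)
      omega
    · omega

lemma second_part (d r : ℕ) (hd : 0 < d) (k : ℕ → ℕ)
    (hk : ∀ i j, 1 ≤ i → i ≤ j → j ≤ r + 1 → k j ≤ k i)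
    (hk0 : k (r + 1) = 0) (R : Polynomial ℂ)
    (hR : R * denom2 d r k = phiPoly2 d r k * numer2 d r k)
    (m : ℕ) (hm : 1 ≤ m) (hm' : m ≤ 2 * r - 1)
    (h0 : phi2 r k (m + 1) = 0) (h1 : phi2 r k m ≠ 0) :
    (Polynomial.rootMultiplicity ((d : ℂ) * (m : ℂ) / 2) (numer2 d r k) =
        Polynomial.rootMultiplicity ((d : ℂ) * (m : ℂ) / 2) (denom2 d r k) ∧
       Polynomial.rootMultiplicity ((d : ℂ) * ((m : ℂ) - 1) / 2) (numer2 d r k) <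
        Polynomial.rootMultiplicity ((d : ℂ) * ((m : ℂ) - 1) / 2) (denom2 d r k)) := by
  have hd1 : (1 : ℝ) ≤ d := by exact_mod_cast hd
  obtain ⟨i, j, hi, hij, hj, hs, hphi⟩ := phi2_mem r k (m + 1) (by omega) (by omega)
  rw [h0] at hphi
  have hle := hk i j hi hij hj
  have hkj : k j = 0 := by omega
  have hki : k i ≤ 1 := by omega
  have hmn : ∀ a b, 1 ≤ a → a ≤ b → b ≤ r + 1 → a + b = m + 1 → 2 ≤ k a + k b := by
    intro a b ha hab hb hs'
    have := phi2_le r k m a b ha hab hb hs'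
    omega
  -- all roots of `R` lie strictly to the left of `d (m - 1) / 2`
  have hroot : ∀ x : ℝ, (d : ℝ) * ((m : ℝ) - 1) / 2 ≤ x → ¬ R.IsRoot (x : ℂ) := by
    intro x hx hr
    by_cases hi1 : i = 1
    · subst hi1
      rw [R_eq_one d r k hk hk0 R hR hki] at hr
      simp at hr
    · have hki1 := hmn (i - 1) j (by omega) (by omega) hj (by omega)
      rcases Nat.lt_or_ge i j with hlt | hge
      · have hki2 := hmn i (j - 1) (by omega) (by omega) (by omega) (by omega)
        have hle' := hk i (j - 1) hi (by omega) (by omega)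
        have hB := (bounds_aux d r hd k hk hk0 1 (i - 1) (j - 1) le_rfl (by omega) (by omega)
          (by omega) (by omega) (by omega) (by
            intro a ha hb
            have := hk i a hi (by omega) (by omega)
            have := hk a (j - 1) (by omega) (by omega) (by omega)
            omega) (by rw [Nat.sub_add_cancel (by omega)]; exact hkj) R hR x hr).2.2.1 (by omega)
        rw [Complex.ofReal_re, Nat.cast_sub (by omega), Nat.cast_sub (by omega)] at hB
        have hsR : (i : ℝ) + j = m + 2 := by exact_mod_cast hs
        have hkR : (2 : ℝ) ≤ k (i - 1) := by
          have : 2 ≤ k (i - 1) := by omega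
          exact_mod_cast this
        have : (i : ℝ) = m + 2 - j := by linarith
        rw [this] at hB
        push_cast at hB
        nlinarith
      · obtain rfl : i = j := by omega
        have hB := (bounds_aux d r hd k hk hk0 1 (i - 1) (i - 1) le_rfl (by omega) (by omega)
          (by omega) (by omega) (by omega) (by
            intro a ha hb
            omega) (by rw [Nat.sub_add_cancel (by omega)]; exact hkj) R hR x hr).2.2.2 rfl
        rw [Complex.ofReal_re, Nat.cast_sub (by omega)] at hB
        have hsR : (i : ℝ) + i = m + 2 := by exact_mod_cast hs
        have hkR : (1 : ℝ) ≤ (((k (i - 1) + 1) / 2 : ℕ) : ℝ) := by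
          have : 1 ≤ (k (i - 1) + 1) / 2 := by omega
          exact_mod_cast this
        have : (m : ℝ) = i + i - 2 := by linarith
        rw [this] at hx
        push_cast at hB
        nlinarith
  have hRm := R_monic d r k R hR
  have hmult : ∀ w : ℂ, R.rootMultiplicity w + (denom2 d r k).rootMultiplicity w =
      (phiPoly2 d r k).rootMultiplicity w + (numer2 d r k).rootMultiplicity w := by
    intro w
    rw [← rootMultiplicity_mul (mul_ne_zero hRm.ne_zero (denom2_monic d r k).ne_zero), hR,
      rootMultiplicity_mul (mul_ne_zero (phiPoly2_monic d r k).ne_zero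
        (numer2_monic d r k).ne_zero)]
  constructor
  · have e1 := hmult ((d : ℂ) * (m : ℂ) / 2)
    have hr := hroot ((d : ℝ) * m / 2) (by nlinarith)
    rw [show (((d : ℝ) * m / 2 : ℝ) : ℂ) = (d : ℂ) * (m : ℂ) / 2 by push_cast; ring] at hr
    have hphi' : ¬ (phiPoly2 d r k).IsRoot ((d : ℂ) * (m : ℂ) / 2) := by
      intro h
      unfold phiPoly2 at h
      rw [IsRoot.def, eval_prod, Finset.prod_eq_zero_iff] at h
      obtain ⟨a, ha, h⟩ := h
      rw [mem_Icc] at ha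
      unfold pochPoly at h
      rw [eval_prod, Finset.prod_eq_zero_iff] at h
      obtain ⟨t, ht, h⟩ := h
      rw [mem_range] at ht
      rw [lin_eq, eval_sub, eval_X, eval_C] at h
      have h' : ((d * m / 2 - (d * (a - 1) / 2 - t) : ℝ) : ℂ) = 0 := by
        push_cast; exact h
      rw [Complex.ofReal_eq_zero] at h'
      have ham : m + 1 ≤ a := by
        by_contra hc
        have hc' : (a : ℝ) ≤ m := by exact_mod_cast (by omega : a ≤ m)
        have : (0 : ℝ) ≤ t := Nat.cast_nonneg t
        nlinarith
      have hz : phi2 r k a = 0 := by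
        rcases Nat.lt_or_ge (i + (r + 1)) (a + 1) with hlt | hge
        · have := phi2_le r k a (a - r) (r + 1) (by omega) (by omega) le_rfl (by omega)
          have := hk i (a - r) hi (by omega) (by omega)
          omega
        · have := phi2_le r k a i (a + 1 - i) hi (by omega) (by omega) (by omega)
          have := hk j (a + 1 - i) (by omega) (by omega) (by omega)
          omega
      omega
    rw [rootMultiplicity_eq_zero hr, rootMultiplicity_eq_zero hphi'] at e1
    omega
  · have e1 := hmult ((d : ℂ) * ((m : ℂ) - 1) / 2)
    have hr := hroot ((d : ℝ) * ((m : ℝ) - 1) / 2) le_rfl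
    rw [show (((d : ℝ) * ((m : ℝ) - 1) / 2 : ℝ) : ℂ) = (d : ℂ) * ((m : ℂ) - 1) / 2 by
      push_cast; ring] at hr
    have hphi' : (phiPoly2 d r k).IsRoot ((d : ℂ) * ((m : ℂ) - 1) / 2) := by
      unfold phiPoly2
      rw [IsRoot.def, eval_prod, Finset.prod_eq_zero_iff]
      refine ⟨m, mem_Icc.2 ⟨hm, by omega⟩, ?_⟩
      unfold pochPoly
      rw [eval_prod, Finset.prod_eq_zero_iff]
      refine ⟨0, mem_range.2 (by omega), ?_⟩
      simp
    have := (rootMultiplicity_pos (phiPoly2_monic d r k).ne_zero).2 hphi'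
    rw [rootMultiplicity_eq_zero hr] at e1
    omega

/-- Proposition 6.4(3): location of the zeros of `(λ)_{φ₂(k),d}·C₂^{d,2d}(λ,k)`,
and the poles/nonvanishing of `C₂^{d,2d}` at `λ = dm/2`, `d(m−1)/2`. -/
theorem zeroes_simple₂ (d r₂ : ℕ) (hd : 0 < d) (hr₂ : 0 < r₂)
    (k : ℕ → ℕ) (hk : ∀ i j, 1 ≤ i → i ≤ j → j ≤ r₂ → k j ≤ k i)
    (hk0 : k (r₂ + 1) = 0)
    (m₁ m₂ m₃ : ℕ) (hm1 : 1 ≤ m₁) (hm2 : 1 ≤ m₂) (hm3 : 1 ≤ m₃) (hm4 : m₃ ≤ r₂)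
    (hm5 : m₁ ≤ m₃) (hm6 : m₂ ≤ m₃)
    (hk1 : k 1 ≤ k m₁ + 1)
    (hkc : ∀ a, m₂ + 1 ≤ a → a ≤ m₃ → k a = 1) (hk3 : k (m₃ + 1) = 0)
    (R : Polynomial ℂ)
    (hR : R * denom2 d r₂ k = phiPoly2 d r₂ k * numer2 d r₂ k) :
    ((2 ≤ k 1 → m₂ < m₃ → ∀ z : ℂ, R.IsRoot z → z.im = 0 ∧
        (d : ℝ) / 2 * (m₁ : ℝ) - (k 1 : ℝ) + 3 / 2 ≤ z.re ∧
        z.re ≤ (d : ℝ) / 2 * ((m₂ : ℝ) + (m₃ : ℝ) - 1) - (k m₂ : ℝ) / 2 + 1 / 2) ∧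
      (2 ≤ k 1 → m₂ = m₃ → ∀ z : ℂ, R.IsRoot z → z.im = 0 ∧
        (d : ℝ) / 2 * (m₁ : ℝ) - (k 1 : ℝ) + 3 / 2 ≤ z.re ∧
        z.re ≤ (d : ℝ) / 2 * (2 * (m₃ : ℝ) - 1) - (((k m₃ + 1) / 2 : ℕ) : ℝ) + 1 / 2) ∧
      (k 1 ≤ 1 → R = 1)) ∧
    ∀ m : ℕ, 1 ≤ m → m ≤ 2 * r₂ - 1 →
      phi2 r₂ k (m + 1) = 0 → phi2 r₂ k m ≠ 0 →
      (Polynomial.rootMultiplicity ((d : ℂ) * (m : ℂ) / 2) (numer2 d r₂ k) =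
        Polynomial.rootMultiplicity ((d : ℂ) * (m : ℂ) / 2) (denom2 d r₂ k) ∧
       Polynomial.rootMultiplicity ((d : ℂ) * ((m : ℂ) - 1) / 2) (numer2 d r₂ k) <
        Polynomial.rootMultiplicity ((d : ℂ) * ((m : ℂ) - 1) / 2) (denom2 d r₂ k)) := by
  have hk' : ∀ i j, 1 ≤ i → i ≤ j → j ≤ r₂ + 1 → k j ≤ k i := by
    intro i j hi hij hj
    rcases Nat.lt_or_ge r₂ j with h | h
    · obtain rfl : j = r₂ + 1 := by omega
      omega
    · exact hk i j hi hij h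
  refine ⟨⟨?_, ?_, ?_⟩, ?_⟩
  · intro _ hlt z hz
    obtain ⟨h1, h2, h3, _⟩ := bounds_aux d r₂ hd k hk' hk0 m₁ m₂ m₃ hm1 hm2 hm4 hm5 hm6 hk1 hkc
      hk3 R hR z hz
    exact ⟨h1, h2, h3 hlt⟩
  · intro _ heq z hz
    obtain ⟨h1, h2, _, h3⟩ := bounds_aux d r₂ hd k hk' hk0 m₁ m₂ m₃ hm1 hm2 hm4 hm5 hm6 hk1 hkc
      hk3 R hR z hz
    exact ⟨h1, h2, h3 heq⟩
  · exact R_eq_one d r₂ k hk' hk0 R hR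
  · intro m hm hm' h0 h1
    exact second_part d r₂ hd k hk' hk0 R hR m hm hm' h0 h1
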